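/- For each n let P_{n,ψ} denote the law on ℝ^n of Y = (Y_1, …, Y_n) with Y_1, …, Y_n i.i.d. N(0, 1 + ψ), and let M_n(Y) = n^{-1} Σ_{i=1}^n Y_i². Suppose ψ_n ∈ [0, ∞) satisfies √n · ψ_n → a for some finite a ∈ [0, ∞). Then the law under P_{n,ψ_n} of the Wald statistic W_n^W = (n/2)^{1/2} { max(M_n(Y) − 1, 0) − ψ_n } / (1 + ψ_n) converges weakly, as n → ∞, to the pushforward of the standard normal distribution N(0,1) under the map w ↦ max(w, −a·2^{-1/2}). -/

import Mathlib

open MeasureTheory ProbabilityTheory Filter Topology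

/-- The law on `ℝ^n` of `n` i.i.d. `N(0, 1 + ψ)` random variables. -/
noncomputable def modelLaw (n : ℕ) (ψ : ℝ) : Measure (Fin n → ℝ) :=
  Measure.pi fun _ => gaussianReal 0 (Real.toNNReal (1 + ψ))

/-- `M_n(y) = n⁻¹ ∑ yᵢ²`. -/
noncomputable def Mstat (n : ℕ) (y : Fin n → ℝ) : ℝ := (∑ i, y i ^ 2) / n

/-- The Wald statistic `W_n^W(ψ) = (n/2)^{1/2} (max(M_n − 1, 0) − ψ)/(1 + ψ)`,
where `max(M_n − 1, 0)` is the maximum likelihood estimator. -/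
noncomputable def waldStat (n : ℕ) (ψ : ℝ) (y : Fin n → ℝ) : ℝ :=
  Real.sqrt (n / 2) * (max (Mstat n y - 1) 0 - ψ) / (1 + ψ)

/-- Derivatives of `p(t) exp(t²/2)`. -/
lemma aux_hasDerivAt (p : ℝ → ℝ) (p' t : ℝ) (hp : HasDerivAt p p' t) :
    HasDerivAt (fun t => p t * Real.exp (t ^ 2 / 2)) ((p' + p t * t) * Real.exp (t ^ 2 / 2)) t := by
  have h : HasDerivAt (fun t : ℝ => Real.exp (t ^ 2 / 2)) (Real.exp (t ^ 2 / 2) * t) t := by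
    have := (((hasDerivAt_id t).pow 2).div_const 2).exp
    refine HasDerivAt.congr_deriv this ?_
    simp
  refine (hp.mul h).congr_deriv ?_
  ring

lemma aux_fourth : ∫ x, x ^ 4 ∂(gaussianReal 0 1) = 3 := by
  have h0 : (0 : ℝ) ∈ interior (integrableExpSet id (gaussianReal 0 1)) := by
    simp [integrableExpSet_id_gaussianReal]
  have h := iteratedDeriv_mgf_zero h0 4
  have e0 : mgf id (gaussianReal 0 1) = fun t => (1 : ℝ) * Real.exp (t ^ 2 / 2) := by
    rw [mgf_id_gaussianReal]; simp
  have e1 : deriv (mgf id (gaussianReal 0 1)) = fun t => t * Real.exp (t ^ 2 / 2) := by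
    rw [e0]; ext t
    rw [(aux_hasDerivAt (fun _ => 1) 0 t (hasDerivAt_const t 1)).deriv]; ring
  have e2 : deriv (fun t : ℝ => t * Real.exp (t ^ 2 / 2))
      = fun t => (1 + t ^ 2) * Real.exp (t ^ 2 / 2) := by
    ext t
    rw [(aux_hasDerivAt (fun t => t) 1 t (hasDerivAt_id t)).deriv]; ring
  have e3 : deriv (fun t : ℝ => (1 + t ^ 2) * Real.exp (t ^ 2 / 2))
      = fun t => (3 * t + t ^ 3) * Real.exp (t ^ 2 / 2) := by
    ext t
    rw [(aux_hasDerivAt (fun t => 1 + t ^ 2) (2 * t) t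
      (by simpa using (hasDerivAt_pow 2 t).const_add 1)).deriv]; ring
  have e4 : deriv (fun t : ℝ => (3 * t + t ^ 3) * Real.exp (t ^ 2 / 2)) 0 = 3 := by
    rw [(aux_hasDerivAt (fun t => 3 * t + t ^ 3) (3 + 3 * 0 ^ 2) 0
      ((((hasDerivAt_id (0 : ℝ)).const_mul 3).add
        (hasDerivAt_pow 3 (0 : ℝ))).congr_deriv (by simp))).deriv]
    simp
  rw [iteratedDeriv_succ, iteratedDeriv_succ, iteratedDeriv_succ, iteratedDeriv_succ,
    iteratedDeriv_zero, e1, e2, e3, e4] at h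
  simpa using h.symm

lemma aux_second : ∫ x, x ^ 2 ∂(gaussianReal 0 1) = 1 := by
  have h := variance_id_gaussianReal (μ := 0) (v := 1)
  rw [variance_eq_integral (by fun_prop)] at h
  simpa using h

lemma aux_integrable (k : ℕ) : Integrable (fun x : ℝ => x ^ k) (gaussianReal 0 1) := by
  have := (memLp_id_gaussianReal (μ := 0) (v := 1) (k : NNReal)).integrable_norm_pow'
  rw [← integrable_norm_iff (by fun_prop)]
  simpa using this

/-- The i.i.d. standard normal law on sequences. -/
noncomputable def seqLaw : Measure (ℕ → ℝ) := Measure.infinitePi fun _ => gaussianReal 0 1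

instance : IsProbabilityMeasure seqLaw := by unfold seqLaw; infer_instance

/-- standardised squares -/
noncomputable def stdSq (x : ℝ) : ℝ := (x ^ 2 - 1) / Real.sqrt 2

lemma measurable_stdSq : Measurable stdSq := by unfold stdSq; fun_prop

lemma seqLaw_eval (k : ℕ) : seqLaw.map (fun ω => ω k) = gaussianReal 0 1 := by
  unfold seqLaw
  exact Measure.infinitePi_map_eval _ k

lemma integral_sq : ∫ x, stdSq x ∂(gaussianReal 0 1) = 0 := by
  unfold stdSq
  rw [integral_div, integral_sub (aux_integrable 2) (integrable_const _), aux_second]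
  simp

lemma integral_sq_sq : ∫ x, stdSq x ^ 2 ∂(gaussianReal 0 1) = 1 := by
  have : ∀ x, stdSq x ^ 2 = (x ^ 4 - (2 * x ^ 2 - 1)) / 2 := by
    intro x; unfold stdSq; rw [div_pow, Real.sq_sqrt (by norm_num)]; ring
  simp_rw [this]
  have hi : Integrable (fun x : ℝ => 2 * x ^ 2 - 1) (gaussianReal 0 1) :=
    ((aux_integrable 2).const_mul 2).sub (integrable_const _)
  rw [integral_div, integral_sub (aux_integrable 4) hi,
    integral_sub ((aux_integrable 2).const_mul 2) (integrable_const _), integral_const_mul,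
    aux_second, aux_fourth]
  simp; norm_num

lemma clt_sq : TendstoInDistribution
    (fun (n : ℕ) (ω : ℕ → ℝ) => (√(n : ℝ))⁻¹ * ∑ k ∈ Finset.range n, stdSq (ω k)) atTop (id : ℝ → ℝ)
      (fun _ => seqLaw) (gaussianReal 0 1) := by
  have := measurable_stdSq
  refine tendstoInDistribution_inv_sqrt_mul_sum 
    (X := fun (k : ℕ) (ω : ℕ → ℝ) => stdSq (ω k)) (HasLaw.id)
    ?_ ?_ ?_ ?_
  · have h := integral_map (μ := seqLaw) (φ := fun ω => ω 0) (measurable_pi_apply 0).aemeasurable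
      (f := stdSq) (by fun_prop)
    rw [← h, seqLaw_eval, integral_sq]
  · have h := integral_map (μ := seqLaw) (φ := fun ω => ω 0) (measurable_pi_apply 0).aemeasurable
      (f := fun x => stdSq x ^ 2) (by fun_prop)
    simp only [Pi.pow_apply]
    rw [← h, seqLaw_eval, integral_sq_sq]
  · exact iIndepFun_infinitePi (fun _ => measurable_stdSq)
  · intro i
    refine IdentDistrib.comp (f := fun ω : ℕ → ℝ => ω i) (g := fun ω : ℕ → ℝ => ω 0)
      ⟨(measurable_pi_apply i).aemeasurable, (measurable_pi_apply 0).aemeasurable, ?_⟩ measurable_stdSq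
    rw [seqLaw_eval, seqLaw_eval]

lemma modelLaw_eq (n : ℕ) (ψ : ℝ) (hψ : 0 ≤ ψ) :
    modelLaw n ψ = seqLaw.map (fun ω (i : Fin n) => √(1 + ψ) * ω i) := by
  have h1 : seqLaw.map (fun ω (i : Fin n) => ω i) = Measure.pi fun _ => gaussianReal 0 1 := by
    unfold seqLaw
    rw [Measure.map_infinitePi_infinitePi_of_inj (f := fun i : Fin n => (i : ℕ))
      Fin.val_injective, Measure.infinitePi_eq_pi]
  have h2 : seqLaw.map (fun ω (i : Fin n) => √(1 + ψ) * ω i)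
      = (seqLaw.map (fun ω (i : Fin n) => ω i)).map (fun y i => √(1 + ψ) * y i) := by
    rw [Measure.map_map (by fun_prop) (by fun_prop)]; rfl
  have h3 : (gaussianReal 0 1).map (fun x => √(1 + ψ) * x)
      = gaussianReal 0 (Real.toNNReal (1 + ψ)) := by
    rw [gaussianReal_map_const_mul]
    congr 1
    · simp
    · ext
      simp [Real.sq_sqrt (by linarith : 0 ≤ 1 + ψ), Real.coe_toNNReal _ (by linarith : 0 ≤ 1 + ψ)]
  rw [h2, h1, Measure.pi_map_pi (by fun_prop), modelLaw]
  simp_rw [h3]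

lemma waldStat_eq (n : ℕ) (ψ : ℝ) (hψ : 0 ≤ ψ) (ω : ℕ → ℝ) :
    waldStat n ψ (fun i : Fin n => √(1 + ψ) * ω i)
      = max ((√(n : ℝ))⁻¹ * ∑ k ∈ Finset.range n, stdSq (ω k)) (-(√(n / 2) * ψ / (1 + ψ))) := by
  rcases Nat.eq_zero_or_pos n with rfl | hn
  · simp [waldStat]
  have hn' : (0 : ℝ) < n := by exact_mod_cast hn
  have h1 : 0 < 1 + ψ := by linarith
  have hs : 0 < √(n : ℝ) := Real.sqrt_pos.2 hn'
  have h2 : 0 < √(2 : ℝ) := by positivity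
  have hc : 0 ≤ √((n : ℝ) / 2) / (1 + ψ) := by positivity
  have e1 : ∀ m : ℝ, √((n : ℝ) / 2) * (max m 0 - ψ) / (1 + ψ)
      = max (√((n : ℝ) / 2) / (1 + ψ) * (m - ψ)) (-(√((n : ℝ) / 2) * ψ / (1 + ψ))) := by
    intro m
    rw [← max_sub_sub_right, mul_div_right_comm, mul_max_of_nonneg _ _ hc]
    congr 1; ring
  unfold waldStat
  rw [e1]
  congr 1
  have e2 : Mstat n (fun i : Fin n => √(1 + ψ) * ω i)
      = (1 + ψ) * (∑ k ∈ Finset.range n, ω k ^ 2) / n := by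
    unfold Mstat
    simp_rw [mul_pow, Real.sq_sqrt h1.le]
    rw [← Finset.mul_sum, Fin.sum_univ_eq_sum_range (fun k => ω k ^ 2)]
  rw [e2]
  unfold stdSq
  rw [← Finset.sum_div, Finset.sum_sub_distrib, Real.sqrt_div hn'.le]
  simp only [Finset.sum_const, Finset.card_range, nsmul_eq_mul, mul_one]
  have e3 : (n : ℝ) = √(n : ℝ) ^ 2 := (Real.sq_sqrt hn'.le).symm
  generalize √(n : ℝ) = s at *
  rw [e3]
  field_simp
  ring

theorem stmt3 (ψ : ℕ → ℝ) (hψ : ∀ n, 0 ≤ ψ n) (a : ℝ) (ha0 : 0 ≤ a)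
    (ha : Tendsto (fun n : ℕ => Real.sqrt (n : ℝ) * ψ n) atTop (𝓝 a)) :
    ∀ f : BoundedContinuousFunction ℝ ℝ,
      Tendsto (fun n => ∫ t, f t ∂(Measure.map (waldStat n (ψ n)) (modelLaw n (ψ n))))
        atTop
        (𝓝 (∫ t, f t ∂(Measure.map (fun w => max w (-(a / Real.sqrt 2)))
            (gaussianReal 0 1)))) := by
  intro f
  have hψ0 : Tendsto ψ atTop (𝓝 0) := by
    have hs : Tendsto (fun n : ℕ => (√(n : ℝ))⁻¹) atTop (𝓝 0) :=
      tendsto_inv_atTop_zero.comp (Real.tendsto_sqrt_atTop.comp tendsto_natCast_atTop_atTop)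
    have h := hs.mul ha
    rw [zero_mul] at h
    refine h.congr' ?_
    filter_upwards [eventually_gt_atTop 0] with n hn
    have : 0 < √(n : ℝ) := Real.sqrt_pos.2 (by exact_mod_cast hn)
    field_simp
  have hc : Tendsto (fun n : ℕ => √((n : ℝ) / 2) * ψ n / (1 + ψ n)) atTop (𝓝 (a / √2)) := by
    have h := (ha.div_const (√2)).div (hψ0.const_add 1) (by norm_num)
    rw [add_zero, div_one] at h
    refine h.congr fun n => ?_
    simp only [Pi.div_apply]
    rw [Real.sqrt_div (Nat.cast_nonneg n)]
    ring
  have hm : TendstoInMeasure seqLaw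
      (fun (n : ℕ) (_ : ℕ → ℝ) => √((n : ℝ) / 2) * ψ n / (1 + ψ n)) atTop
      (fun _ => a / √2) :=
    tendstoInMeasure_of_tendsto_ae (fun n => by fun_prop) (ae_of_all _ fun _ => hc)
  have key := clt_sq.continuous_comp_prodMk_of_tendstoInMeasure_const
    (g := fun p : ℝ × ℝ => max p.1 (-p.2)) (by fun_prop) hm (fun n => by fun_prop)
  have h := (ProbabilityMeasure.tendsto_iff_forall_integral_tendsto.1 key.tendsto) f
  refine h.congr fun n => ?_
  simp only [ProbabilityMeasure.coe_mk]
  congr 1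
  rw [modelLaw_eq n _ (hψ n), Measure.map_map _ (by fun_prop)]
  · congr 1
    ext ω
    exact (waldStat_eq n _ (hψ n) ω).symm
  · unfold waldStat Mstat
    fun_prop
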